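/- arXiv:2605.31334 — 3 statements merged into one kernel-verified Lean document; each statement's English description precedes it below -/
import Mathlib

section
/- For every alternating 4-form β on ℝ⁸, β ∧ Φ₀ = ⟨β, Φ₀⟩·vol₀, where ⟨·,·⟩ is the inner product on alternating 4-forms making the forms e^{i₁}∧e^{i₂}∧e^{i₃}∧e^{i₄} with i₁<i₂<i₃<i₄ an orthonormal basis. (This expresses the self-duality *Φ₀ = Φ₀ of the Cayley form.) -/
open scoped TensorProduct
open Matrix

noncomputable section

/-- `ℝ⁸` with its standard basis. -/
abbrev V : Type := Fin 8 → ℝ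

/-- Alternating `k`-forms on `ℝ⁸`. -/
abbrev Form (k : ℕ) : Type := V [⋀^Fin k]→ₗ[ℝ] ℝ

/-- Standard basis vector `eᵢ` of `ℝ⁸`. -/
def e (i : Fin 8) : V := Pi.single i 1

/-- The elementary 4-form `eⁱ∧eʲ∧eᵏ∧eˡ` (determinant convention). -/
def E4 (i j k l : Fin 8) : Form 4 :=
  (Matrix.detRowAlternating : (Fin 4 → ℝ) [⋀^Fin 4]→ₗ[ℝ] ℝ).compLinearMap
    (LinearMap.funLeft ℝ ℝ ![i, j, k, l])

/-- The Cayley 4-form `Φ₀` on `ℝ⁸` (indices shifted from `1,…,8` to `0,…,7`):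
`Φ₀ = e^{1234}+e^{1256}+e^{1278}+e^{1357}−e^{1368}−e^{1458}−e^{1467}
      +e^{5678}+e^{3478}+e^{3456}+e^{2468}−e^{2457}−e^{2367}−e^{2358}`. -/
def Φ₀ : Form 4 :=
  E4 0 1 2 3 + E4 0 1 4 5 + E4 0 1 6 7 + E4 0 2 4 6 - E4 0 2 5 7 - E4 0 3 4 7 - E4 0 3 5 6
    + E4 4 5 6 7 + E4 2 3 6 7 + E4 2 3 4 5 + E4 1 3 5 7 - E4 1 3 4 6 - E4 1 2 5 6 - E4 1 2 4 7

/-- The standard volume form `e¹∧e²∧⋯∧e⁸` of `ℝ⁸`. -/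
def vol₀ : Form 8 := Matrix.detRowAlternating

/-- The wedge product of alternating forms (shuffle convention, so that
`(e¹∧e²)(e₁,e₂) = 1`). -/
def wedge {k l : ℕ} (α : Form k) (β : Form l) : Form (k + l) :=
  AlternatingMap.domDomCongr finSumFinEquiv
    ((LinearMap.mul' ℝ ℝ).compAlternatingMap (AlternatingMap.domCoprod α β))

/-- The double contraction `v ⌟ w ⌟ Φ`, i.e. the alternating 2-form
`(x, y) ↦ Φ (w, v, x, y)`. -/
def contr (v w : V) (Φ : Form 4) : Form 2 :=
  AlternatingMap.curryLeft (AlternatingMap.curryLeft Φ w) v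

/-- The inner product on alternating `k`-forms on `ℝ⁸` making the forms
`e^{i₁}∧⋯∧e^{i_k}` with `i₁<⋯<i_k` an orthonormal basis. -/
def formInner {k : ℕ} (α β : Form k) : ℝ :=
  ∑ s : Finset (Fin 8),
    if h : s.card = k then
      α (fun a => e ((s.orderIsoOfFin h a : Fin 8))) *
        β (fun a => e ((s.orderIsoOfFin h a : Fin 8)))
    else 0

/-- A 4-form `Ψ` on `ℝ⁸` is admissible (a `Spin(7)`-form) if `Ψ = g*Φ₀` for some
`g ∈ GL(8,ℝ)`, where `(g*Φ₀)(x,y,z,w) = Φ₀(gx,gy,gz,gw)`. -/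
def Admissible (Ψ : Form 4) : Prop :=
  ∃ g : V →ₗ[ℝ] V, Function.Bijective g ∧ Ψ = Φ₀.compLinearMap g

/-- The permutation of `Fin k ⊕ Fin l` listing the elements of `s` in increasing order, followed by
those of `sᶜ` in increasing order. -/
def shufflePerm {k l : ℕ} (s : Finset (Fin (k + l))) (hs : s.card = k) (hs' : sᶜ.card = l) :
    Equiv.Perm (Fin k ⊕ Fin l) :=
  (finSumEquivOfFinset hs hs').trans finSumFinEquiv.symm

theorem card_compl_of_card_eq {k l : ℕ} {s : Finset (Fin (k + l))} (hs : s.card = k) :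
    sᶜ.card = l := by
  simp [Finset.card_compl, hs]

theorem range_shufflePerm_inl {k l : ℕ} {s : Finset (Fin (k + l))} (hs : s.card = k)
    (hs' : sᶜ.card = l) :
    Set.range (fun a => finSumFinEquiv (shufflePerm s hs hs' (Sum.inl a))) = s := by
  simp [shufflePerm]

theorem shufflePerm_bijective (k l : ℕ) :
    Function.Bijective (fun s : {s : Finset (Fin (k + l)) // s.card = k} =>
      (QuotientGroup.mk (shufflePerm s.1 s.2 (card_compl_of_card_eq s.2)) :
        Equiv.Perm.ModSumCongr (Fin k) (Fin l))) := by
  constructor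
  · rintro ⟨s, hs⟩ ⟨t, ht⟩ h
    obtain ⟨⟨p, q⟩, hpq⟩ := QuotientGroup.eq.1 h
    rw [eq_inv_mul_iff_mul_eq] at hpq
    rw [Subtype.mk.injEq, ← Finset.coe_inj,
      ← range_shufflePerm_inl hs (card_compl_of_card_eq hs),
      ← range_shufflePerm_inl ht (card_compl_of_card_eq ht), ← hpq]
    exact (p.surjective.range_comp
      (fun a => finSumFinEquiv (shufflePerm s hs (card_compl_of_card_eq hs) (Sum.inl a)))).symm
  · intro q
    induction q using QuotientGroup.induction_on with | _ σ
    let s : Finset (Fin (k + l)) := Finset.univ.image fun a => finSumFinEquiv (σ (Sum.inl a))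
    have hs : s.card = k := by
      refine (Finset.card_image_of_injective _ ?_).trans (Finset.card_fin k)
      exact finSumFinEquiv.injective.comp (σ.injective.comp Sum.inl_injective)
    refine ⟨⟨s, hs⟩, QuotientGroup.eq.2 (Equiv.Perm.mem_sumCongrHom_range_of_perm_mapsTo_inl ?_)⟩
    rintro _ ⟨a, rfl⟩
    have ha : finSumFinEquiv (σ (Sum.inl a)) ∈ (s : Set (Fin (k + l))) := by simp [s]
    rw [← range_shufflePerm_inl hs (card_compl_of_card_eq hs)] at ha
    obtain ⟨b, hb⟩ := ha
    exact ⟨b, by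
      rw [Equiv.Perm.mul_apply, ← finSumFinEquiv.injective hb, Equiv.Perm.inv_def,
        Equiv.symm_apply_apply]⟩

/-- The sign of the shuffle attached to `s`, as a product over pairs in `sᶜ × s`. -/
def shuffleSign {n : ℕ} (s : Finset (Fin n)) : ℤˣ :=
  ∏ j ∈ sᶜ, ∏ i ∈ s, if i < j then 1 else -1

theorem Finset.prod_orderEmbOfFin {α M : Type*} [LinearOrder α] [CommMonoid M] {k : ℕ}
    (s : Finset α) (hs : s.card = k) (f : α → M) :
    ∏ a, f (s.orderEmbOfFin hs a) = ∏ i ∈ s, f i := by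
  rw [← Finset.prod_coe_sort s]
  exact (s.orderIsoOfFin hs).toEquiv.prod_comp fun i : s => f i

theorem sign_shufflePerm {k l : ℕ} (s : Finset (Fin (k + l))) (hs : s.card = k)
    (hs' : sᶜ.card = l) : Equiv.Perm.sign (shufflePerm s hs hs') = shuffleSign s := by
  rw [← Equiv.Perm.sign_symm_trans_trans _ finSumFinEquiv, Equiv.Perm.sign_eq_prod_prod_Iio,
    Fin.prod_univ_add]
  have hl (i : Fin k) : (finSumFinEquiv.symm.trans (shufflePerm s hs hs')).trans finSumFinEquiv
      (Fin.castAdd l i) = s.orderEmbOfFin hs i := by simp [shufflePerm]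
  have hr (j : Fin l) : (finSumFinEquiv.symm.trans (shufflePerm s hs hs')).trans finSumFinEquiv
      (Fin.natAdd k j) = sᶜ.orderEmbOfFin hs' j := by simp [shufflePerm]
  rw [Finset.prod_eq_one, one_mul, shuffleSign, ← Finset.prod_orderEmbOfFin _ hs']
  · refine Finset.prod_congr rfl fun j _ => ?_
    rw [← Finset.prod_orderEmbOfFin s hs, ← Finset.filter_gt_eq_Iio, Finset.prod_filter,
      Fin.prod_univ_add]
    have hlt (i : Fin k) : Fin.castAdd l i < Fin.natAdd k j := by
      simp [Fin.lt_def]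
      omega
    simp only [hl, hr, hlt, if_true]
    rw [mul_eq_left]
    refine Finset.prod_eq_one fun i _ => ?_
    by_cases h : i < j <;> simp [h]
  · intro j _
    refine Finset.prod_eq_one fun i hi => ?_
    rw [Finset.mem_Iio] at hi
    obtain ⟨i, rfl⟩ : ∃ i', i = Fin.castAdd l i' :=
      ⟨⟨i, (Fin.lt_def.1 hi).trans j.2⟩, rfl⟩
    rw [hl, hl, if_pos]
    rw [OrderEmbedding.lt_iff_lt]
    exact hi

theorem wedge_apply {k l : ℕ} (α : Form k) (β : Form l) (v : Fin (k + l) → V) :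
    wedge α β v = ∑ s : {s : Finset (Fin (k + l)) // s.card = k},
      ((shuffleSign s.1 : ℤ) : ℝ) * (α (fun a => v (s.1.orderEmbOfFin s.2 a)) *
        β (fun a => v (s.1ᶜ.orderEmbOfFin (card_compl_of_card_eq s.2) a))) := by
  simp only [wedge, AlternatingMap.domDomCongr_apply, LinearMap.compAlternatingMap_apply,
    AlternatingMap.domCoprod_apply, _root_.sum_apply, map_sum]
  rw [← (shufflePerm_bijective k l).sum_comp]
  refine Finset.sum_congr rfl fun s _ => ?_
  have h := AlternatingMap.domCoprod.summand_mk'' α β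
    (shufflePerm s.1 s.2 (card_compl_of_card_eq s.2))
  refine (congrArg (fun m => LinearMap.mul' ℝ ℝ (m (v ∘ finSumFinEquiv))) h).trans ?_
  rw [sign_shufflePerm, Units.smul_def, _root_.smul_apply, map_zsmul, zsmul_eq_mul]
  simp [shufflePerm]

theorem formInner_eq_sum {k : ℕ} (α β : Form k) :
    formInner α β = ∑ s : {s : Finset (Fin 8) // s.card = k},
      α (fun a => e (s.1.orderEmbOfFin s.2 a)) * β (fun a => e (s.1.orderEmbOfFin s.2 a)) := by
  rw [formInner, ← Fintype.sum_subtype_add_sum_subtype (fun s : Finset (Fin 8) => s.card = k),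
    Fintype.sum_eq_zero (fun s : {s : Finset (Fin 8) // ¬s.card = k} => _) fun s => dif_neg s.2,
    add_zero]
  exact Finset.sum_congr rfl fun s _ => dif_pos s.2

theorem E4_orderEmbOfFin (s : Finset (Fin 8)) (hs : s.card = 4) {i j k l : Fin 8}
    (hij : i < j) (hjk : j < k) (hkl : k < l) :
    E4 i j k l (fun a => e (s.orderEmbOfFin hs a)) =
      ((if s = {i, j, k, l} then 1 else 0 : ℤ) : ℝ) := by
  have hmono : StrictMono ![i, j, k, l] := by
    rw [Fin.strictMono_iff_lt_succ]
    intro a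
    fin_cases a <;> simpa
  change Matrix.det (Matrix.of fun a b => e (s.orderEmbOfFin hs a) (![i, j, k, l] b)) = _
  split_ifs with h
  · have hf := Finset.orderEmbOfFin_unique hs (f := ![i, j, k, l])
      (fun a => by subst h; fin_cases a <;> simp) hmono
    rw [← hf]
    rw [Int.cast_one, ← Matrix.det_one (n := Fin 4) (R := ℝ)]
    congr 1
    ext a b
    simp [e, Pi.single_apply, Matrix.one_apply, hmono.injective.eq_iff, eq_comm]
  · obtain ⟨b, hb⟩ : ∃ b, ![i, j, k, l] b ∉ s := by
      by_contra! hall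
      refine h (Finset.eq_of_subset_of_card_le (fun x hx => ?_) ?_).symm
      · simp only [Finset.mem_insert, Finset.mem_singleton] at hx
        rcases hx with rfl | rfl | rfl | rfl
        exacts [hall 0, hall 1, hall 2, hall 3]
      · have hcard := Finset.card_image_of_injective Finset.univ hmono.injective
        refine (hs.trans (hcard.trans (Finset.card_fin 4)).symm).trans_le ?_
        refine Finset.card_le_card fun x hx => ?_
        obtain ⟨a, -, rfl⟩ := Finset.mem_image.1 hx
        fin_cases a <;> simp
    rw [Matrix.det_eq_zero_of_column_eq_zero b, Int.cast_zero]
    intro a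
    refine Pi.single_eq_of_ne ?_ _
    rintro h'
    exact hb (h' ▸ s.orderEmbOfFin_mem hs a)

/-- The coefficient of `Φ₀` along the elementary form with increasing indices in `s`. -/
def cayleyCoeff (s : Finset (Fin 8)) : ℤ :=
  let d (i j k l : Fin 8) : ℤ := if s = {i, j, k, l} then 1 else 0
  d 0 1 2 3 + d 0 1 4 5 + d 0 1 6 7 + d 0 2 4 6 - d 0 2 5 7 - d 0 3 4 7 - d 0 3 5 6
    + d 4 5 6 7 + d 2 3 6 7 + d 2 3 4 5 + d 1 3 5 7 - d 1 3 4 6 - d 1 2 5 6 - d 1 2 4 7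

theorem Φ₀_orderEmbOfFin (s : Finset (Fin 8)) (hs : s.card = 4) :
    Φ₀ (fun a => e (s.orderEmbOfFin hs a)) = (cayleyCoeff s : ℝ) := by
  simp only [Φ₀, cayleyCoeff, AlternatingMap.add_apply, AlternatingMap.sub_apply]
  repeat rw [E4_orderEmbOfFin s hs (by decide) (by decide) (by decide)]
  push_cast
  rfl

theorem shuffleSign_mul_cayleyCoeff_compl :
    ∀ s : Finset (Fin 8), s.card = 4 → (shuffleSign s : ℤ) * cayleyCoeff sᶜ = cayleyCoeff s := by
  decide +kernel

theorem eq_smul_vol₀ (ω : Form 8) : ω = ω e • vol₀ := by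
  have he : ⇑(Pi.basisFun ℝ (Fin 8)) = e := by
    ext1 i
    simp [e]
  simpa only [he, Pi.basisFun_det, vol₀] using ω.eq_smul_basis_det (Pi.basisFun ℝ (Fin 8))

/-- **Self-duality of the Cayley form (`*Φ₀ = Φ₀`):** for every alternating 4-form `β`
on `ℝ⁸`, `β ∧ Φ₀ = ⟨β, Φ₀⟩ · vol₀`, where `⟨·,·⟩` is the inner product on 4-forms making
the forms `e^{i₁}∧e^{i₂}∧e^{i₃}∧e^{i₄}` with `i₁<i₂<i₃<i₄` an orthonormal basis. -/
theorem cayley_self_dual (β : Form 4) : wedge β Φ₀ = formInner β Φ₀ • vol₀ := by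
  refine (eq_smul_vol₀ (wedge (k := 4) (l := 4) β Φ₀)).trans (congrArg (· • vol₀) ?_)
  refine (wedge_apply (k := 4) (l := 4) β Φ₀ e).trans ?_
  rw [formInner_eq_sum]
  refine Finset.sum_congr rfl fun s _ => ?_
  have hs := shuffleSign_mul_cayleyCoeff_compl s.1 s.2
  rw [Φ₀_orderEmbOfFin, Φ₀_orderEmbOfFin, ← hs]
  push_cast
  ring

end
end

section
/- The Cayley form is non-degenerate: for any three linearly independent vectors u, v, w ∈ ℝ⁸ there exists x ∈ ℝ⁸ such that Φ₀(u,v,w,x) ≠ 0. -/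
open scoped TensorProduct
open Matrix

noncomputable section

theorem E4_apply (i j k l : Fin 8) (u v w x : V) :
    E4 i j k l ![u, v, w, x] =
      !![u i, u j, u k, u l; v i, v j, v k, v l; w i, w j, w k, w l; x i, x j, x k, x l].det := by
  refine congrArg (Matrix.det (R := ℝ) (n := Fin 4)) ?_
  ext a b
  fin_cases a <;> fin_cases b <;> rfl

set_option maxHeartbeats 4000000 in
set_option maxRecDepth 20000 in
/-- The triple cross product defined by `Φ₀` has squared norm the Gram determinant. -/
theorem sum_sq_Φ₀_eq_det_gram (u v w : V) :
    ∑ i, Φ₀ ![u, v, w, e i] ^ 2 = (Matrix.of ![u, v, w] * (Matrix.of ![u, v, w])ᵀ).det := by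
  simp only [Matrix.det_fin_three, Matrix.mul_apply, Matrix.transpose_apply, Matrix.of_apply]
  simp [Φ₀, E4_apply, Matrix.det_succ_row_zero, Fin.sum_univ_succ, e, Fin.succAbove,
    Pi.single_apply]
  ring

/-- **Non-degeneracy of the Cayley form:** for any three linearly independent vectors
`u, v, w ∈ ℝ⁸` there exists `x ∈ ℝ⁸` such that `Φ₀ (u, v, w, x) ≠ 0`. -/
theorem cayley_nondegenerate (u v w : V) (h : LinearIndependent ℝ ![u, v, w]) :
    ∃ x : V, Φ₀ ![u, v, w, x] ≠ 0 := by
  by_contra! hx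
  have hpos := (Matrix.PosDef.mul_conjTranspose_self (Matrix.of ![u, v, w])
    (Matrix.vecMul_injective_iff.mpr h)).det_pos
  rw [Matrix.conjTranspose_eq_transpose_of_trivial, ← sum_sq_Φ₀_eq_det_gram] at hpos
  simp [hx] at hpos

end
end

section
/- The 28-dimensional space of alternating 2-forms on ℝ⁸ is the orthogonal direct sum of Λ²₇ := ker(M − 3·id) and Λ²₂₁ := ker(M + id), and dim Λ²₇ = 7 while dim Λ²₂₁ = 21. -/
open scoped TensorProduct
open Matrix

noncomputable section

/-- The elementary form `e^{f 0} ∧ ⋯ ∧ e^{f (k-1)}` (determinant convention). -/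
def elemForm {k : ℕ} (f : Fin k → Fin 8) : Form k :=
  (Matrix.detRowAlternating : (Fin k → ℝ) [⋀^Fin k]→ₗ[ℝ] ℝ).compLinearMap
    (LinearMap.funLeft ℝ ℝ f)

lemma elemForm_apply {k : ℕ} (f : Fin k → Fin 8) (v : Fin k → V) :
    elemForm f v = (Matrix.of fun a b => v a (f b)).det := rfl

lemma vol₀_eq_elemForm : vol₀ = elemForm id := by
  have h : LinearMap.funLeft ℝ ℝ (id : Fin 8 → Fin 8) = LinearMap.id := rfl
  rw [vol₀, elemForm, h, AlternatingMap.compLinearMap_id]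

lemma elemForm_eq_alternatization {k : ℕ} (f : Fin k → Fin 8) :
    elemForm f = MultilinearMap.alternatization
      ((MultilinearMap.mkPiAlgebra ℝ (Fin k) ℝ).compLinearMap
        fun a => (LinearMap.proj (f a) : V →ₗ[ℝ] ℝ)) := by
  ext v
  rw [elemForm_apply, Matrix.det_apply, MultilinearMap.alternatization_apply]
  rfl

lemma wedge_elemForm {k l : ℕ} (f : Fin k → Fin 8) (g : Fin l → Fin 8) :
    wedge (elemForm f) (elemForm g) = elemForm (Fin.append f g) := by
  ext v
  rw [elemForm_apply, ← Matrix.det_submatrix_equiv_self finSumFinEquiv, Matrix.det_apply, wedge,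
    elemForm_eq_alternatization, elemForm_eq_alternatization,
    ← MultilinearMap.domCoprod_alternization]
  simp only [AlternatingMap.domDomCongr_apply, LinearMap.compAlternatingMap_apply,
    MultilinearMap.alternatization_apply, map_sum]
  refine Finset.sum_congr rfl fun σ _ => ?_
  rw [Units.smul_def, Units.smul_def, map_zsmul]
  simp [Fintype.prod_sum_type]

lemma wedge_add {k l : ℕ} (α : Form k) (β γ : Form l) :
    wedge α (β + γ) = wedge α β + wedge α γ := by
  ext v
  simp [wedge, ← AlternatingMap.domCoprod'_apply, TensorProduct.tmul_add]

lemma wedge_sub {k l : ℕ} (α : Form k) (β γ : Form l) :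
    wedge α (β - γ) = wedge α β - wedge α γ := by
  ext v
  simp [wedge, ← AlternatingMap.domCoprod'_apply, TensorProduct.tmul_sub]

/-- The product of the signs `±1` (or `0` on equality) of the comparisons of `a` with the entries
of a list. -/
def rowSign (a : ℕ) : List ℕ → ℤ
  | [] => 1
  | b :: l => bif a == b then 0 else bif a.blt b then rowSign a l else -rowSign a l

/-- The sign of the permutation sorting a list, and `0` if it has repeated entries. -/
def listSign : List ℕ → ℤ
  | [] => 1
  | a :: l => bif l.elem a then 0 else rowSign a l * listSign l

lemma rowSign_eq_prod (a : ℕ) (l : List ℕ) :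
    rowSign a l = (l.map fun b => if a < b then (1 : ℤ) else if a = b then 0 else -1).prod := by
  induction l with
  | nil => rfl
  | cons b l ih =>
    rcases lt_trichotomy a b with h | rfl | h
    · simp [rowSign, ih, Nat.blt, h, h.ne, Bool.cond_eq_ite]
    · simp [rowSign]
    · simp [rowSign, ih, Nat.blt, Bool.cond_eq_ite, h.not_gt, h.ne']

lemma listSign_ofFn {n : ℕ} (f : Fin n → ℕ) :
    listSign (List.ofFn f) =
      ∏ i, ∏ j ∈ Finset.Ioi i, if f i < f j then (1 : ℤ) else if f i = f j then 0 else -1 := by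
  induction n with
  | zero => simp [listSign]
  | succ n ih =>
    rw [List.ofFn_succ, listSign, ih, Fin.prod_univ_succ, Fin.prod_Ioi_zero, rowSign_eq_prod,
      List.map_ofFn, List.prod_ofFn]
    simp only [Fin.prod_Ioi_succ, Function.comp_apply]
    rw [Bool.cond_eq_ite]
    split_ifs with h
    · rw [List.elem_iff, List.mem_ofFn] at h
      obtain ⟨j, hj⟩ := h
      rw [Finset.prod_eq_zero (Finset.mem_univ j) (by simp [hj]), zero_mul]
    · rfl

lemma elemForm_e (f : Fin 8 → Fin 8) :
    elemForm f e = listSign (List.ofFn fun i => (f i : ℕ)) := by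
  rw [elemForm_apply, listSign_ofFn]
  by_cases hf : Function.Injective f
  · let σ : Equiv.Perm (Fin 8) := Equiv.ofBijective f (Finite.injective_iff_bijective.1 hf)
    have h1 : (Matrix.of fun a b => e a (f b)) = (1 : Matrix (Fin 8) (Fin 8) ℝ).submatrix id σ := by
      ext a b
      simp [e, Matrix.one_apply, Pi.single_apply, σ, eq_comm]
    rw [h1, Matrix.det_permute', Matrix.det_one, mul_one, Equiv.Perm.sign_eq_prod_prod_Ioi]
    push_cast
    refine Finset.prod_congr rfl fun i _ => Finset.prod_congr rfl fun j hj => ?_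
    have hne : (f i : ℕ) ≠ f j := fun h => (Finset.mem_Ioi.1 hj).ne (hf (Fin.ext h))
    simp only [σ, Equiv.ofBijective_apply, Fin.lt_def, hne]
    split_ifs <;> simp_all
  · simp only [Function.Injective, not_forall] at hf
    obtain ⟨i, j, hij, hne⟩ := hf
    wlog h : i < j generalizing i j
    · exact this j i hij.symm (Ne.symm hne) (lt_of_le_of_ne (not_lt.1 h) (Ne.symm hne))
    rw [Finset.prod_eq_zero (Finset.mem_univ i)
      (Finset.prod_eq_zero (Finset.mem_Ioi.2 h) (by simp [hij])), Int.cast_zero]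
    exact Matrix.det_zero_of_column_eq hne fun a => by simp [hij]

/-- Index type of the coordinates `α(eᵢ, eⱼ)`, `i < j`, of a 2-form. -/
abbrev Pairs : Type := {p : Fin 8 × Fin 8 // p.1 < p.2}

/-- The entries of a pair, as a function on `Fin 2`. -/
def Pairs.vec (p : Pairs) : Fin 2 → Fin 8 := ![p.1.1, p.1.2]

/-- The sign with which `e^{ij}` occurs in the self-dual 2-form spanning `Λ²₇` together with the
other `e^{kl}` whose indices have the same bitwise exclusive or. -/
def pairSign (p : Pairs) : ℤ :=
  if p.1 ∈ [((1 : Fin 8), (3 : Fin 8)), (1, 5), (1, 7), (2, 5), (2, 6), (3, 4), (3, 5), (4, 7),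
    (5, 6), (5, 7)] then -1 else 1

/-- The matrix of `M + id` in the basis `e^{ij}`, `i < j`. -/
def blockMatrix : Matrix Pairs Pairs ℤ := fun p q =>
  if p.1.1.val ^^^ p.1.2.val = q.1.1.val ^^^ q.1.2.val then pairSign p * pairSign q else 0

/-- The coefficient of `vol₀` in `e^{ij} ∧ e^{kl} ∧ Φ₀`. -/
def wedgeCoeff (p q : Pairs) : ℤ :=
  let s (i j k l : ℕ) := listSign [p.1.1, p.1.2, q.1.1, q.1.2, i, j, k, l]
  s 0 1 2 3 + s 0 1 4 5 + s 0 1 6 7 + s 0 2 4 6 - s 0 2 5 7 - s 0 3 4 7 - s 0 3 5 6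
    + s 4 5 6 7 + s 2 3 6 7 + s 2 3 4 5 + s 1 3 5 7 - s 1 3 4 6 - s 1 2 5 6 - s 1 2 4 7

lemma wedgeCoeff_eq : ∀ p q : Pairs,
    wedgeCoeff p q = blockMatrix p q - if p = q then 1 else 0 := by
  decide +kernel

lemma blockMatrix_mul_self : blockMatrix * blockMatrix = (4 : ℤ) • blockMatrix := by
  decide +kernel

lemma trace_blockMatrix : blockMatrix.trace = 28 := by
  decide +kernel

lemma blockMatrix_symm (p q : Pairs) : blockMatrix p q = blockMatrix q p := by
  simp only [blockMatrix, eq_comm, mul_comm]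

lemma wedge_wedge_elemForm (p q : Pairs) :
    wedge (wedge (elemForm p.vec) (elemForm q.vec)) Φ₀ e = wedgeCoeff p q := by
  have h4 (i j k l : Fin 8) : wedge (wedge (elemForm p.vec) (elemForm q.vec)) (E4 i j k l) e =
      listSign [p.1.1, p.1.2, q.1.1, q.1.2, i, j, k, l] := by
    rw [wedge_elemForm, show E4 i j k l = elemForm ![i, j, k, l] from rfl, wedge_elemForm,
      elemForm_e]
    rfl
  simp only [Φ₀, wedge_add, wedge_sub, AlternatingMap.add_apply, AlternatingMap.sub_apply, h4,
    wedgeCoeff]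
  push_cast
  rfl

lemma elemForm_vec_apply (p q : Pairs) :
    elemForm p.vec (fun a => e (q.vec a)) = if p = q then 1 else 0 := by
  have key : (if q.1.1 = p.1.1 then 1 else 0) * (if q.1.2 = p.1.2 then 1 else 0) -
      (if q.1.1 = p.1.2 then 1 else 0) * (if q.1.2 = p.1.1 then 1 else 0) =
      if p = q then (1 : ℤ) else 0 := by
    revert p q
    decide +kernel
  rw [elemForm_apply, Matrix.det_fin_two]
  simp only [Matrix.of_apply, Pairs.vec, e, Pi.single_apply, Matrix.cons_val_zero,
    Matrix.cons_val_one, @eq_comm _ p.1.1, @eq_comm _ p.1.2]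
  exact_mod_cast congrArg (Int.cast : ℤ → ℝ) key

lemma sum_smul_elemForm_apply (c : Pairs → ℝ) (q : Pairs) :
    (∑ p : Pairs, c p • elemForm p.vec) (fun a => e (q.vec a)) = c q := by
  let ev : Form 2 →ₗ[ℝ] ℝ :=
    { toFun α := α fun a => e (q.vec a)
      map_add' _ _ := rfl
      map_smul' _ _ := rfl }
  refine (map_sum ev (fun p : Pairs => c p • elemForm p.vec) Finset.univ).trans ?_
  simp [ev, elemForm_vec_apply]

/-- A 2-form is determined by its coordinates `α(eᵢ, eⱼ)`, `i < j`. -/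
def coordEquiv : Form 2 ≃ₗ[ℝ] (Pairs → ℝ) where
  toFun α p := α fun a => e (p.vec a)
  invFun c := ∑ p : Pairs, c p • elemForm p.vec
  map_add' _ _ := rfl
  map_smul' _ _ := rfl
  right_inv c := by
    ext q
    exact sum_smul_elemForm_apply c q
  left_inv α := by
    let β : Form 2 := ∑ p : Pairs, (α fun a => e (p.vec a)) • elemForm p.vec
    have h (q : Pairs) : β (fun a => e (q.vec a)) = α (fun a => e (q.vec a)) :=
      sum_smul_elemForm_apply _ q
    refine Module.Basis.ext_alternating (Pi.basisFun ℝ (Fin 8)) fun v hv => ?_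
    have hb : (fun i => Pi.basisFun ℝ (Fin 8) (v i)) = fun i => e (v i) := by
      ext i; simp [e]
    rw [hb]
    change β _ = α _
    rcases lt_or_gt_of_ne (hv.ne (show (0 : Fin 2) ≠ 1 by decide)) with hlt | hlt
    · have hs : (fun i => e (v i)) = fun a : Fin 2 => e (Pairs.vec ⟨(v 0, v 1), hlt⟩ a) := by
        funext a; fin_cases a <;> rfl
      rw [hs, h]
    · have hs : (fun i => e (v i)) =
          (fun a : Fin 2 => e (Pairs.vec ⟨(v 1, v 0), hlt⟩ a)) ∘ Equiv.swap (0 : Fin 2) 1 := by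
        funext a; fin_cases a <;> rfl
      rw [hs, AlternatingMap.map_swap _ _ (by decide), AlternatingMap.map_swap _ _ (by decide), h]

/-- The basis `e^{ij}`, `i < j`, of the space of 2-forms. -/
def formBasis : Module.Basis Pairs ℝ (Form 2) := Module.Basis.ofEquivFun coordEquiv

lemma formBasis_apply (p : Pairs) : formBasis p = elemForm p.vec := by
  rw [formBasis, Module.Basis.coe_ofEquivFun, LinearEquiv.symm_apply_eq]
  ext q
  simp [coordEquiv, elemForm_vec_apply, Pi.single_apply, eq_comm]

lemma formBasis_repr (α : Form 2) (p : Pairs) :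
    formBasis.repr α p = α fun a => e (p.vec a) := rfl

lemma formInner_eq_sum_s8 (α β : Form 2) :
    formInner α β = ∑ p, formBasis.repr α p * formBasis.repr β p := by
  symm
  have hinj : Function.Injective fun p : Pairs => ({p.1.1, p.1.2} : Finset (Fin 8)) := by
    unfold Function.Injective
    decide +kernel
  refine Finset.sum_of_injOn (fun p : Pairs => ({p.1.1, p.1.2} : Finset (Fin 8))) hinj.injOn
    (by simp) (fun s _ hs => ?_) fun p _ => ?_
  · refine dif_neg fun hc => hs ?_
    obtain ⟨x, y, hxy, rfl⟩ := Finset.card_eq_two.1 hc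
    rcases lt_or_gt_of_ne hxy with h | h
    · exact ⟨⟨(x, y), h⟩, by simp, rfl⟩
    · exact ⟨⟨(y, x), h⟩, by simp, Finset.pair_comm _ _⟩
  · have hc : ({p.1.1, p.1.2} : Finset (Fin 8)).card = 2 := Finset.card_pair p.2.ne
    have hv : p.vec = Finset.orderEmbOfFin _ hc := by
      refine Finset.orderEmbOfFin_unique hc (fun a => ?_) fun a b hab => ?_
      · fin_cases a <;> simp [Pairs.vec]
      · fin_cases a <;> fin_cases b <;> first | exact p.2 | simp at hab
    simp only [dif_pos hc, formBasis_repr, hv]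
    rfl

/-- An endomorphism with matrix `blockMatrix` is self-adjoint. -/
lemma formInner_map_comm {T : Form 2 →ₗ[ℝ] Form 2}
    (hT : LinearMap.toMatrix formBasis formBasis T = blockMatrix.map (Int.cast : ℤ → ℝ))
    (α β : Form 2) : formInner (T α) β = formInner α (T β) := by
  have h : (blockMatrix.map (Int.cast : ℤ → ℝ))ᵀ = blockMatrix.map (Int.cast : ℤ → ℝ) := by
    ext p q
    simp [blockMatrix_symm p q]
  have hd (α β : Form 2) : formInner α β = formBasis.repr α ⬝ᵥ formBasis.repr β :=
    formInner_eq_sum_s8 α β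
  rw [hd, hd, ← LinearMap.toMatrix_mulVec_repr formBasis formBasis T α,
    ← LinearMap.toMatrix_mulVec_repr formBasis formBasis T β, hT, Matrix.dotProduct_mulVec,
    ← Matrix.mulVec_transpose, h]

/-- A 2-form endomorphism representing `α ∧ β ∧ Φ₀` has the matrix `blockMatrix - 1`. -/
lemma toMatrix_add_one (M : Form 2 →ₗ[ℝ] Form 2)
    (hM : ∀ α β : Form 2, wedge (wedge α β) Φ₀ = formInner (M α) β • vol₀) :
    LinearMap.toMatrix formBasis formBasis (M + 1) = blockMatrix.map (Int.cast : ℤ → ℝ) := by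
  ext q p
  have hv : vol₀ e = 1 := by
    rw [vol₀_eq_elemForm, elemForm_e,
      show listSign (List.ofFn fun i : Fin 8 => ((id i : Fin 8) : ℕ)) = 1 by decide, Int.cast_one]
  have h := congrArg (fun ω : Form 8 => ω e) (hM (formBasis p) (formBasis q))
  have h2 : formBasis.repr (M (formBasis p)) q = wedgeCoeff p q := by
    rw [← wedge_wedge_elemForm, ← formBasis_apply, ← formBasis_apply]
    refine Eq.trans ?_ h.symm
    simp [hv, formInner_eq_sum_s8, Finsupp.single_apply]
  rw [LinearMap.toMatrix_apply, LinearMap.add_apply, map_add, Finsupp.add_apply, h2,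
    wedgeCoeff_eq, Matrix.map_apply, blockMatrix_symm q p]
  simp [Finsupp.single_apply]

/-- **The `Spin(7)`-decomposition `Λ² = Λ²₇ ⊕ Λ²₂₁`:** the 28-dimensional space of
alternating 2-forms on `ℝ⁸` is the orthogonal direct sum of `Λ²₇ := ker(M − 3·id)` and
`Λ²₂₁ := ker(M + id)`, with `dim Λ²₇ = 7` and `dim Λ²₂₁ = 21`. Here `M` is the unique
endomorphism of 2-forms with `α∧β∧Φ₀ = ⟨Mα, β⟩·vol₀` for all `α, β`. -/
theorem two_forms_decomposition (M : Form 2 →ₗ[ℝ] Form 2)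
    (hM : ∀ α β : Form 2, wedge (wedge α β) Φ₀ = formInner (M α) β • vol₀) :
    Module.finrank ℝ (Form 2) = 28 ∧
    (∀ α ∈ LinearMap.ker (M - (3 : ℝ) • LinearMap.id),
      ∀ β ∈ LinearMap.ker (M + LinearMap.id), formInner α β = 0) ∧
    IsCompl (LinearMap.ker (M - (3 : ℝ) • LinearMap.id)) (LinearMap.ker (M + LinearMap.id)) ∧
    Module.finrank ℝ (LinearMap.ker (M - (3 : ℝ) • LinearMap.id)) = 7 ∧
    Module.finrank ℝ (LinearMap.ker (M + LinearMap.id)) = 21 := by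
  have hmat := toMatrix_add_one M hM
  have hrank : Module.finrank ℝ (Form 2) = 28 := by
    rw [Module.finrank_eq_card_basis formBasis]
    decide +kernel
  have : Module.Finite ℝ (Form 2) := Module.Finite.of_basis formBasis
  have hsq : (M + 1) * (M + 1) = (4 : ℝ) • (M + 1) := by
    apply (LinearMap.toMatrix formBasis formBasis).injective
    rw [LinearMap.toMatrix_mul, map_smul, hmat, ← Matrix.map_mul_intCast, blockMatrix_mul_self]
    ext p q
    rw [Matrix.map_apply, Matrix.smul_apply, Matrix.smul_apply, Matrix.map_apply]
    simp
  have htr : LinearMap.trace ℝ (Form 2) (M + 1) = 28 := by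
    rw [LinearMap.trace_eq_matrix_trace ℝ formBasis, hmat]
    have h := congrArg (Int.cast : ℤ → ℝ) trace_blockMatrix
    simp only [Matrix.trace, Matrix.diag_apply, Int.cast_sum, Int.cast_ofNat] at h
    exact h
  set P : Form 2 →ₗ[ℝ] Form 2 := (4⁻¹ : ℝ) • (M + 1) with hP
  have hidem : IsIdempotentElem P := by
    rw [IsIdempotentElem, hP, smul_mul_smul_comm, hsq, smul_smul]
    norm_num
  have hker : LinearMap.ker P = LinearMap.ker (M + LinearMap.id) :=
    LinearMap.ker_smul _ _ (by norm_num)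
  have hrange : LinearMap.range P = LinearMap.ker (M - (3 : ℝ) • LinearMap.id) := by
    rw [LinearMap.IsIdempotentElem.range_eq_ker_one_sub hidem,
      ← LinearMap.ker_smul (M - (3 : ℝ) • LinearMap.id) (-4⁻¹ : ℝ) (by norm_num)]
    congr 1
    rw [hP, ← Module.End.one_eq_id]
    module
  have hdim : Module.finrank ℝ (LinearMap.range P) = 7 := by
    have : Module.Free ℝ (LinearMap.range P) :=
      @Module.Free.of_divisionRing ℝ (LinearMap.range P) _ (Submodule.addCommGroup _) _
    have : Module.Free ℝ (LinearMap.ker P) :=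
      @Module.Free.of_divisionRing ℝ (LinearMap.ker P) _ (Submodule.addCommGroup _) _
    have h := (LinearMap.IsIdempotentElem.isProj_range P hidem).trace
    rw [hP, map_smul, htr] at h
    have h7 : ((Module.finrank ℝ (LinearMap.range P) : ℕ) : ℝ) = (7 : ℕ) := by
      rw [← h]
      norm_num
    exact_mod_cast h7
  rw [← hrange, ← hker]
  refine ⟨hrank, fun α hα β hβ => ?_, LinearMap.IsIdempotentElem.isCompl hidem, hdim, ?_⟩
  · rw [hrange, LinearMap.mem_ker] at hα
    rw [hker, LinearMap.mem_ker] at hβ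
    have h1 : (M + 1) α = (4 : ℝ) • α := by
      have h3 : M α = (3 : ℝ) • α := sub_eq_zero.1 hα
      rw [LinearMap.add_apply, h3, Module.End.one_apply]
      module
    have h2 : (M + 1) β = 0 := hβ
    have h := formInner_map_comm hmat α β
    rw [h1, h2, formInner_eq_sum_s8, formInner_eq_sum_s8] at h
    rw [formInner_eq_sum_s8]
    simpa [mul_assoc, ← Finset.mul_sum] using h
  · have h := LinearMap.finrank_range_add_finrank_ker P
    omega

end
end
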